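/- The four two-qubit Bell states Φ⁺ = (|00⟩ + |11⟩)/√2, Φ⁻ = (|00⟩ − |11⟩)/√2, Ψ⁺ = (|01⟩ + |10⟩)/√2, Ψ⁻ = (|01⟩ − |10⟩)/√2 cannot be perfectly distinguished by a PPT measurement: there do not exist 4×4 positive semidefinite complex matrices E₁, E₂, E₃, E₄ whose partial transposes are also positive semidefinite, with E₁ + E₂ + E₃ + E₄ = I₄ and Tr(E_i |B_j⟩⟨B_j|) = δ_{ij} for all i, j ∈ {1,2,3,4}, where B₁, B₂, B₃, B₄ denote the four Bell states. -/

import Mathlib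

open Matrix BigOperators ComplexOrder

/-- The partial transpose (on the second factor) of an operator on `ℂ² ⊗ ℂ²`:
`M^Γ((i,j),(k,l)) = M((i,l),(k,j))`. -/
def partialTranspose (M : Matrix (Fin 2 × Fin 2) (Fin 2 × Fin 2) ℂ) :
    Matrix (Fin 2 × Fin 2) (Fin 2 × Fin 2) ℂ :=
  fun p q => M (p.1, q.2) (q.1, p.2)

/-- The four Bell states `Φ⁺, Φ⁻, Ψ⁺, Ψ⁻`. -/
noncomputable def Bell : Fin 4 → (Fin 2 × Fin 2 → ℂ)
  | 0 => fun q => if q = (0, 0) then (Real.sqrt 2 : ℂ)⁻¹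
      else if q = (1, 1) then (Real.sqrt 2 : ℂ)⁻¹ else 0
  | 1 => fun q => if q = (0, 0) then (Real.sqrt 2 : ℂ)⁻¹
      else if q = (1, 1) then -(Real.sqrt 2 : ℂ)⁻¹ else 0
  | 2 => fun q => if q = (0, 1) then (Real.sqrt 2 : ℂ)⁻¹
      else if q = (1, 0) then (Real.sqrt 2 : ℂ)⁻¹ else 0
  | 3 => fun q => if q = (0, 1) then (Real.sqrt 2 : ℂ)⁻¹
      else if q = (1, 0) then -(Real.sqrt 2 : ℂ)⁻¹ else 0

/-- The four Bell states cannot be perfectly distinguished by a PPT measurement: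
there is no POVM `(E_i)` with all `E_i` and their partial transposes positive
semidefinite such that `Tr(E_i |B_j⟩⟨B_j|) = δ_{ij}`. -/
theorem bell_states_not_PPT_distinguishable :
    ¬ ∃ E : Fin 4 → Matrix (Fin 2 × Fin 2) (Fin 2 × Fin 2) ℂ,
      (∀ i, (E i).PosSemidef) ∧
      (∀ i, (partialTranspose (E i)).PosSemidef) ∧
      (∑ i, E i = 1) ∧
      (∀ i j, (E i * vecMulVec (Bell j) (star (Bell j))).trace
          = if i = j then 1 else 0) := by
  rintro ⟨E, -, hP, -, hT⟩
  have hs : ((Real.sqrt 2 : ℝ) : ℂ)⁻¹ * ((Real.sqrt 2 : ℝ) : ℂ)⁻¹ = 1 / 2 := by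
    rw [← mul_inv, ← Complex.ofReal_mul, Real.mul_self_sqrt (by norm_num)]
    norm_num
  have h0 := hT 0 0
  have h1 := hT 0 1
  have h2 := hT 0 2
  have h3 := hT 0 3
  have h := (hP 0).dotProduct_mulVec_nonneg
    (fun q => if q = (0, 1) then 1 else if q = (1, 0) then -1 else 0)
  simp [Matrix.trace, Matrix.mul_apply, vecMulVec_apply, Fintype.sum_prod_type, Bell] at h0 h1 h2 h3
  simp [dotProduct, mulVec, Fintype.sum_prod_type, partialTranspose] at h
  generalize ((Real.sqrt 2 : ℝ) : ℂ)⁻¹ = s at *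
  have key : ∀ z : ℂ, 0 ≤ z → z = -1 → False := by
    rintro z hz rfl
    have := (Complex.le_def.1 hz).1
    norm_num at this
  rw [hs] at h0 h1 h2 h3
  refine key _ h ?_
  linear_combination h1 - h0 + h2 + h3
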